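/- arXiv:1604.08828 — 4 statements merged into one kernel-verified Lean document; each statement's English description precedes it below -/
import Mathlib

section
/- Let m₁, m₂ ≥ 2 be even integers, β₁, β₂ ≥ 1 odd integers, l₁, l₂ ≥ 2 integers, and let Δ₁, Δ₂ ∈ ℤ[t,t⁻¹] be Laurent polynomials with Δ₁(−1) ≠ 0 and Δ₂(−1) ≠ 0, together with finite families G¹₁,…,G¹_{r₁} and G²₁,…,G²_{r₂} of Laurent polynomials in ℤ[t,t⁻¹]. If the ideals I(Δ₁; G¹₁,…,G¹_{r₁}; m₁, β₁, l₁) and I(Δ₂; G²₁,…,G²_{r₂}; m₂, β₂, l₂) of ℤ[t,t⁻¹] are equal, then |Δ₁(−1)| = |Δ₂(−1)|. (This is the algebraic core of Theorem 1(1) of the paper: for branched twist spins K₁^{m₁,n₁}, K₂^{m₂,n₂} with m₁, m₂ even, equivalence forces equality of the knot determinants |Δ_{K₁}(−1)| = |Δ_{K₂}(−1)|.) -/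
open LaurentPolynomial

/-- Evaluation of a Laurent polynomial over `ℤ` at a unit `u` of `ℤ`. -/
noncomputable def evalUnit (u : ℤˣ) : LaurentPolynomial ℤ →+* ℤ :=
  ((AddMonoidAlgebra.lift ℤ ℤ ℤ) ((Units.coeHom ℤ).comp (zpowersHom ℤˣ u))).toRingHom

/-- The ring endomorphism of `ℤ[t,t⁻¹]` sending `t` to `t^β`. -/
noncomputable def substPow (β : ℤ) : LaurentPolynomial ℤ →+* LaurentPolynomial ℤ :=
  AddMonoidAlgebra.mapDomainRingHom ℤ (AddMonoidHom.mulLeft β)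

/-- The four Laurent polynomials `1 - t^m`, `1 - t^β`, `∑_{k=0}^{m-1} t^{kβ}`,
`∑_{k=0}^{β-1} t^{km}`. -/
noncomputable def fourU (m β : ℕ) : Set (LaurentPolynomial ℤ) :=
  {1 - T (m : ℤ), 1 - T (β : ℤ),
   ∑ k ∈ Finset.range m, T ((k : ℤ) * β),
   ∑ k ∈ Finset.range β, T ((k : ℤ) * m)}

/-- The ideal `I(Δ; G₁,…,G_r; m, β, l)` of `ℤ[t,t⁻¹]` generated by `Δ(t^β)·u`,
`G_j(t^β)·(1-t^m)·u` and `(1-t^m)^(l-1)·u`, where `u` ranges over the four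
Laurent polynomials `1-t^m`, `1-t^β`, `∑_{k<m} t^{kβ}`, `∑_{k<β} t^{km}`. -/
noncomputable def twistIdeal (Δ : LaurentPolynomial ℤ) {r : ℕ}
    (G : Fin r → LaurentPolynomial ℤ) (m β l : ℕ) : Ideal (LaurentPolynomial ℤ) :=
  Ideal.span
    ((fun u => substPow (β : ℤ) Δ * u) '' fourU m β ∪
     (⋃ j : Fin r, (fun u => substPow (β : ℤ) (G j) * (1 - T (m : ℤ)) * u) '' fourU m β) ∪
     (fun u => (1 - T (m : ℤ)) ^ (l - 1) * u) '' fourU m β)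

theorem evalUnit_T (u : ℤˣ) (n : ℤ) : evalUnit u (T n) = ((u ^ n : ℤˣ) : ℤ) :=
  (AddMonoidAlgebra.lift_single _ _ _).trans (by simp)

theorem evalUnit_substPow (u : ℤˣ) (β : ℤ) (p : LaurentPolynomial ℤ) :
    evalUnit u (substPow β p) = evalUnit (u ^ β) p := by
  have hT (n : ℤ) : substPow β (T n) = T (β * n) :=
    AddMonoidAlgebra.mapDomain_single
  induction p using LaurentPolynomial.induction_on' with
  | add p q hp hq => simp only [map_add, hp, hq]
  | C_mul_T n a =>
    have hC : (C a : LaurentPolynomial ℤ) = (a : LaurentPolynomial ℤ) := eq_intCast C a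
    simp only [hC, map_mul, map_intCast, hT, evalUnit_T, zpow_mul]

theorem neg_one_zpow_mul_of_odd {β : ℕ} (hβ : Odd β) (k : ℕ) :
    (((-1 : ℤˣ) ^ ((k : ℤ) * β) : ℤˣ) : ℤ) = (-1) ^ k := by
  rw [mul_comm, zpow_mul, zpow_natCast, zpow_natCast, hβ.neg_one_pow]
  simp

theorem neg_one_zpow_mul_of_even {m : ℕ} (hm : Even m) (k : ℕ) :
    (((-1 : ℤˣ) ^ ((k : ℤ) * m) : ℤˣ) : ℤ) = 1 := by
  rw [mul_comm, zpow_mul, zpow_natCast, zpow_natCast, hm.neg_one_pow, one_pow, Units.val_one]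

/-- For `m` even and `β` odd, `twistIdeal Δ G m β l` maps onto the ideal generated by `Δ(-1)`
under evaluation at `-1`. -/
theorem map_evalUnit_neg_one_twistIdeal (Δ : LaurentPolynomial ℤ) {r : ℕ}
    (G : Fin r → LaurentPolynomial ℤ) {m β l : ℕ} (hm : Even m) (hβ : Odd β) (hl : 2 ≤ l) :
    (twistIdeal Δ G m β l).map (evalUnit (-1)) = Ideal.span {evalUnit (-1) Δ} := by
  have hTm : evalUnit (-1) (1 - T (m : ℤ)) = 0 := by
    simpa [evalUnit_T, sub_eq_zero] using (neg_one_zpow_mul_of_even hm 1).symm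
  have hTβ : evalUnit (-1) (1 - T (β : ℤ)) = 2 := by
    have h := neg_one_zpow_mul_of_odd hβ 1
    rw [Nat.cast_one, one_mul] at h
    rw [map_sub, map_one, evalUnit_T, h]
    norm_num
  have hsum : evalUnit (-1) (∑ k ∈ Finset.range β, T ((k : ℤ) * m)) = β := by
    simp [map_sum, evalUnit_T, neg_one_zpow_mul_of_even hm]
  have hsubst : evalUnit (-1) (substPow (β : ℤ) Δ) = evalUnit (-1) Δ := by
    rw [evalUnit_substPow, zpow_natCast, hβ.neg_one_pow]
  have hmem {u : LaurentPolynomial ℤ} (hu : u ∈ fourU m β) :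
      evalUnit (-1) Δ * evalUnit (-1) u ∈ (twistIdeal Δ G m β l).map (evalUnit (-1)) := by
    rw [← hsubst, ← map_mul]
    exact Ideal.mem_map_of_mem _ (Ideal.subset_span (Or.inl (Or.inl ⟨u, hu, rfl⟩)))
  apply le_antisymm
  · rw [twistIdeal, Ideal.map_span, Ideal.span_le]
    rintro _ ⟨x, (⟨u, -, rfl⟩ | hx) | ⟨u, -, rfl⟩, rfl⟩
    · rw [SetLike.mem_coe, Ideal.mem_span_singleton, map_mul, hsubst]
      exact dvd_mul_right _ _
    · obtain ⟨j, u, -, rfl⟩ := Set.mem_iUnion.mp hx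
      simp [map_mul, hTm]
    · have hl' : l - 1 ≠ 0 := by omega
      simp only [map_mul, map_pow, hTm, zero_pow hl', zero_mul]
      exact Submodule.zero_mem _
  · rw [Ideal.span_singleton_le_iff_mem]
    have htwo := hmem (u := 1 - T (β : ℤ)) (by simp [fourU])
    have hodd := hmem (u := ∑ k ∈ Finset.range β, T ((k : ℤ) * m)) (by simp [fourU])
    rw [hTβ] at htwo
    rw [hsum] at hodd
    obtain ⟨c, hc⟩ := hβ
    convert sub_mem hodd (Ideal.mul_mem_right (c : ℤ) _ htwo) using 1
    rw [hc]
    push_cast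
    ring

/-- Algebraic core of Theorem 1(1): if `m₁, m₂` are even and the first elementary
ideals of the branched twist spins coincide, then the knot determinants agree. -/
theorem stmt0 (m₁ m₂ β₁ β₂ l₁ l₂ : ℕ)
    (hm₁ : 2 ≤ m₁) (hm₂ : 2 ≤ m₂) (hm₁e : Even m₁) (hm₂e : Even m₂)
    (hβ₁ : 1 ≤ β₁) (hβ₂ : 1 ≤ β₂) (hβ₁o : Odd β₁) (hβ₂o : Odd β₂)
    (hl₁ : 2 ≤ l₁) (hl₂ : 2 ≤ l₂)
    (Δ₁ Δ₂ : LaurentPolynomial ℤ)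
    (hΔ₁ : evalUnit (-1) Δ₁ ≠ 0) (hΔ₂ : evalUnit (-1) Δ₂ ≠ 0)
    {r₁ r₂ : ℕ} (G₁ : Fin r₁ → LaurentPolynomial ℤ) (G₂ : Fin r₂ → LaurentPolynomial ℤ)
    (h : twistIdeal Δ₁ G₁ m₁ β₁ l₁ = twistIdeal Δ₂ G₂ m₂ β₂ l₂) :
    |evalUnit (-1) Δ₁| = |evalUnit (-1) Δ₂| := by
  have hmap := congrArg (Ideal.map (evalUnit (-1))) h
  rw [map_evalUnit_neg_one_twistIdeal Δ₁ G₁ hm₁e hβ₁o hl₁,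
    map_evalUnit_neg_one_twistIdeal Δ₂ G₂ hm₂e hβ₂o hl₂,
    Ideal.span_singleton_eq_span_singleton] at hmap
  exact abs_eq_abs.mpr (Int.associated_iff.mp hmap)
end

section
/- Let m₁ ≥ 2 be an even integer, β₁ ≥ 1 an odd integer, l₁ ≥ 2 an integer, and Δ₁ ∈ ℤ[t,t⁻¹] a Laurent polynomial with Δ₁(−1) ≠ 0, together with a finite family G¹₁,…,G¹_{r₁} ⊆ ℤ[t,t⁻¹]. Let m₂ ≥ 1 be an odd integer, β₂ ≥ 2 an even integer, l₂ ≥ 1 an integer, and Δ₂ ∈ ℤ[t,t⁻¹] a Laurent polynomial with Δ₂(1) = 1, together with a finite family G²₁,…,G²_{r₂} ⊆ ℤ[t,t⁻¹]. If the ideals I(Δ₁; G¹₁,…,G¹_{r₁}; m₁, β₁, l₁) and I(Δ₂; G²₁,…,G²_{r₂}; m₂, β₂, l₂) of ℤ[t,t⁻¹] are equal, then |Δ₁(−1)| = 1. (This is the algebraic core of Theorem 1(2) of the paper: if m₁ is even, m₂ is odd and |Δ_{K₁}(−1)| ≠ 1, the branched twist spins K₁^{m₁,n₁} and K₂^{m₂,n₂}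 are not equivalent.) -/
open LaurentPolynomial

theorem substPow_T (β n : ℤ) : substPow β (T n) = T (β * n) :=
  AddMonoidAlgebra.mapDomain_single

/-- If `m` is even and `β` is odd, every value at `-1` of an element of the ideal is a multiple
of `Δ(-1)`. -/
theorem evalUnit_dvd_of_mem_twistIdeal {Δ : LaurentPolynomial ℤ} {r : ℕ}
    {G : Fin r → LaurentPolynomial ℤ} {m β l : ℕ} (hm : Even m) (hβ : Odd β) (hl : 2 ≤ l)
    {x : LaurentPolynomial ℤ} (hx : x ∈ twistIdeal Δ G m β l) :
    evalUnit (-1) Δ ∣ evalUnit (-1) x := by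
  have hT : evalUnit (-1) (1 - T (m : ℤ)) = 0 := by simp [evalUnit_T, hm.neg_one_pow]
  suffices h : twistIdeal Δ G m β l ≤
      (Ideal.span {evalUnit (-1) Δ}).comap (evalUnit (-1)) from
    Ideal.mem_span_singleton.mp (h hx)
  refine Ideal.span_le.mpr ?_
  rintro _ ((⟨u, -, rfl⟩ | hG) | ⟨u, -, rfl⟩) <;>
    simp only [SetLike.mem_coe, Ideal.mem_comap, Ideal.mem_span_singleton]
  · simp [evalUnit_substPow, hβ.neg_one_pow]
  · obtain ⟨j, u, -, rfl⟩ := Set.mem_iUnion.mp hG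
    simp only [map_mul, hT, mul_zero, zero_mul, dvd_zero]
  · simp only [map_mul, map_pow, hT, zero_pow (show l - 1 ≠ 0 by omega), zero_mul, dvd_zero]

/-- If `u` is one of the four polynomials, then `Δ(t^β) * u` lies in the ideal. -/
theorem substPow_mul_mem_twistIdeal (Δ : LaurentPolynomial ℤ) {r : ℕ}
    (G : Fin r → LaurentPolynomial ℤ) {m β : ℕ} (l : ℕ) {u : LaurentPolynomial ℤ}
    (hu : u ∈ fourU m β) : substPow (β : ℤ) Δ * u ∈ twistIdeal Δ G m β l :=
  Ideal.subset_span (Or.inl (Or.inl ⟨u, hu, rfl⟩))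

/-- Algebraic core of Theorem 1(2): if `m₁` is even, `m₂` is odd (with `β₂` even) and
the first elementary ideals coincide, then `|Δ₁(-1)| = 1`. -/
theorem stmt1 (m₁ β₁ l₁ m₂ β₂ l₂ : ℕ)
    (hm₁ : 2 ≤ m₁) (hm₁e : Even m₁) (hβ₁ : 1 ≤ β₁) (hβ₁o : Odd β₁) (hl₁ : 2 ≤ l₁)
    (hm₂ : 1 ≤ m₂) (hm₂o : Odd m₂) (hβ₂ : 2 ≤ β₂) (hβ₂e : Even β₂) (hl₂ : 1 ≤ l₂)
    (Δ₁ Δ₂ : LaurentPolynomial ℤ)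
    (hΔ₁ : evalUnit (-1) Δ₁ ≠ 0) (hΔ₂ : evalUnit 1 Δ₂ = 1)
    {r₁ r₂ : ℕ} (G₁ : Fin r₁ → LaurentPolynomial ℤ) (G₂ : Fin r₂ → LaurentPolynomial ℤ)
    (h : twistIdeal Δ₁ G₁ m₁ β₁ l₁ = twistIdeal Δ₂ G₂ m₂ β₂ l₂) :
    |evalUnit (-1) Δ₁| = 1 := by
  have dvd {u : LaurentPolynomial ℤ} (hu : u ∈ fourU m₂ β₂) :
      evalUnit (-1) Δ₁ ∣ evalUnit (-1) u := by
    have hmem := substPow_mul_mem_twistIdeal Δ₂ G₂ l₂ hu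
    rw [← h] at hmem
    simpa [evalUnit_substPow, hβ₂e.neg_one_pow, hΔ₂] using
      evalUnit_dvd_of_mem_twistIdeal hm₁e hβ₁o hl₁ hmem
  have dvd_two : evalUnit (-1) Δ₁ ∣ 2 := by
    have heval : evalUnit (-1) (1 - T (m₂ : ℤ)) = 2 := by
      simp [evalUnit_T, hm₂o.neg_one_pow]
    exact heval ▸ dvd (by simp [fourU])
  have dvd_m₂ : evalUnit (-1) Δ₁ ∣ (m₂ : ℤ) := by
    have hpow (k : ℕ) : (-1 : ℤˣ) ^ ((k : ℤ) * β₂) = 1 := by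
      rw [mul_comm, zpow_mul, zpow_natCast, zpow_natCast, hβ₂e.neg_one_pow, one_pow]
    simpa [evalUnit_T, hpow] using
      dvd (u := ∑ k ∈ Finset.range m₂, T ((k : ℤ) * β₂)) (by simp [fourU])
  obtain ⟨k, rfl⟩ := hm₂o
  refine Int.isUnit_iff_abs_eq.mp (isUnit_of_dvd_one ?_)
  have hdvd := dvd_sub dvd_m₂ (dvd_two.mul_right k)
  push_cast at hdvd
  rwa [add_sub_cancel_left] at hdvd
end

section
/- Let m ≥ 2 be an even integer, β ≥ 1 an odd integer, l ≥ 2 an integer, Δ ∈ ℤ[t,t⁻¹] a Laurent polynomial, and G₁,…,G_r ∈ ℤ[t,t⁻¹] a finite family. Then the image of the ideal I(Δ; G₁,…,G_r; m, β, l) under the evaluation homomorphism ε₋₁ : ℤ[t,t⁻¹] → ℤ, t ↦ −1, is exactly the ideal Δ(−1)·ℤ of ℤ. (This is the computation used in the proof of Theorem 1 of the paper: substituting t = −1 into the generators of the first elementary ideal E₁(K^{m,n}) when m is even, the generators evaluate to 2Δ(−1) and βΔ(−1) or to 0, and gcd(2,β)=1.) -/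
open LaurentPolynomial

theorem evalUnit_C_mul_T (u : ℤˣ) (a n : ℤ) :
    evalUnit u (C a * T n) = a * ((u ^ n : ℤˣ) : ℤ) := by
  rw [← LaurentPolynomial.single_eq_C_mul_T]
  change AddMonoidAlgebra.lift ℤ ℤ ℤ _ (AddMonoidAlgebra.single n a) = _
  rw [AddMonoidAlgebra.lift_single]
  simp

theorem substPow_C_mul_T (β a n : ℤ) : substPow β (C a * T n) = C a * T (β * n) := by
  rw [← LaurentPolynomial.single_eq_C_mul_T, ← LaurentPolynomial.single_eq_C_mul_T]
  exact AddMonoidAlgebra.mapDomain_single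

/-- The values at `t = -1` of the four Laurent polynomials, for `m` even and `β` odd. -/
theorem evalUnit_neg_one_image_fourU {m β : ℕ} (hm : Even m) (hβ : Odd β) :
    evalUnit (-1) '' fourU m β = {0, 2, (β : ℤ)} := by
  have hTm : evalUnit (-1) (T (m : ℤ)) = 1 := by simp [evalUnit_T, hm.neg_one_pow]
  have hTβ : evalUnit (-1) (T (β : ℤ)) = -1 := by simp [evalUnit_T, hβ.neg_one_pow]
  have hsum_m : evalUnit (-1) (∑ k ∈ Finset.range m, T ((k : ℤ) * β)) = 0 := by
    have h (k : ℕ) : evalUnit (-1) (T ((k : ℤ) * β)) = (-1) ^ k := by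
      rw [evalUnit_T, mul_comm, zpow_mul, zpow_natCast, zpow_natCast, hβ.neg_one_pow]
      simp
    simp only [map_sum, h, neg_one_geom_sum, if_pos hm]
  have hsum_β : evalUnit (-1) (∑ k ∈ Finset.range β, T ((k : ℤ) * m)) = β := by
    have h (k : ℕ) : evalUnit (-1) (T ((k : ℤ) * m)) = 1 := by
      rw [evalUnit_T, mul_comm, zpow_mul, zpow_natCast, zpow_natCast, hm.neg_one_pow]
      simp
    simp [map_sum, h]
  simp only [fourU, Set.image_insert_eq, Set.image_singleton, map_sub, map_one, hTm, hTβ,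
    hsum_m, hsum_β]
  ext x
  simp only [Set.mem_insert_iff, Set.mem_singleton_iff]
  norm_num
  tauto

/-- When `m` is even and `β` is odd, the image of `I(Δ; G; m, β, l)` under evaluation
at `t = -1` is exactly the ideal of `ℤ` generated by `Δ(-1)`. -/
theorem stmt2 (m β l : ℕ) (hm : 2 ≤ m) (hme : Even m) (hβ : 1 ≤ β) (hβo : Odd β)
    (hl : 2 ≤ l) (Δ : LaurentPolynomial ℤ) {r : ℕ} (G : Fin r → LaurentPolynomial ℤ) :
    (twistIdeal Δ G m β l).map (evalUnit (-1)) = Ideal.span {evalUnit (-1) Δ} := by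
  have hTm : evalUnit (-1) (T (m : ℤ)) = 1 := by simp [evalUnit_T, hme.neg_one_pow]
  have hsub (p : LaurentPolynomial ℤ) :
      evalUnit (-1) (substPow (β : ℤ) p) = evalUnit (-1) p := by
    rw [evalUnit_substPow, zpow_natCast, hβo.neg_one_pow]
  have hvalues := evalUnit_neg_one_image_fourU hme hβo
  rw [twistIdeal, Ideal.map_span]
  apply le_antisymm
  · rw [Ideal.span_le]
    rintro _ ⟨_, (⟨u, -, rfl⟩ | hG) | ⟨u, -, rfl⟩, rfl⟩
    · simpa only [map_mul, hsub, SetLike.mem_coe] using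
        Ideal.mul_mem_right _ _ (Ideal.mem_span_singleton_self _)
    · obtain ⟨j, u, -, rfl⟩ := Set.mem_iUnion.1 hG
      simp [hTm]
    · simp [hTm, zero_pow (show l - 1 ≠ 0 by omega)]
  · rw [Ideal.span_singleton_le_iff_mem]
    have hgen {x : ℤ} (hx : x ∈ ({0, 2, (β : ℤ)} : Set ℤ)) :
        evalUnit (-1) Δ * x ∈ Ideal.span (evalUnit (-1) ''
          ((fun u => substPow (β : ℤ) Δ * u) '' fourU m β ∪
          (⋃ j : Fin r, (fun u => substPow (β : ℤ) (G j) * (1 - T (m : ℤ)) * u) '' fourU m β) ∪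
          (fun u => (1 - T (m : ℤ)) ^ (l - 1) * u) '' fourU m β)) := by
      rw [← hvalues] at hx
      obtain ⟨u, hu, rfl⟩ := hx
      exact Ideal.subset_span ⟨_, .inl (.inl ⟨u, hu, rfl⟩), by simp only [map_mul, hsub]⟩
    obtain ⟨k, hk⟩ := hβo
    have hcomb := sub_mem (hgen (x := β) (by simp))
      (Ideal.mul_mem_right (k : ℤ) _ (hgen (x := 2) (by simp)))
    convert hcomb using 1
    rw [hk]
    push_cast
    ring
end

section
/- Let R be an integral domain, l ≥ 1 an integer, B an l×l matrix over R each of whose rows sums to zero (Σ_j B_{i,j} = 0 for every i), and a, b, c, d ∈ R with a·d = b·c and (a,b) ≠ (0,0). Let A be the associated (2l+1)×(l+1) matrix. Then for every choice of l+1 of the 2l+1 rows of A, the determinant of the resulting (l+1)×(l+1) matrix is zero. (This is the abstract form of Lemma 3.1(1) of the paper: the zeroth elementary ideal E₀(K^{m,n}) of an (m,n)-branched twist spin vanishes, since every maximal minor of its Alexander matrix is zero.) -/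
/-- The associated `(2l+1) × (l+1)` matrix built from an `l × l` matrix `B` and ring
elements `a, b, c, d`: the first `l` rows are the rows of `B` followed by a `0`; the
next `l` rows are `a` on the diagonal (other entries `0`) with last entry `b`; the
last row is `(c, 0, …, 0, d)`. Rows are indexed by `Fin l ⊕ Fin l ⊕ Unit` and columns
by `Fin l ⊕ Unit`. -/
def assocMatrix {R : Type*} [CommRing R] {l : ℕ} (B : Matrix (Fin l) (Fin l) R)
    (a b c d : R) : Matrix (Fin l ⊕ (Fin l ⊕ Unit)) (Fin l ⊕ Unit) R :=
  fun i j =>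
    match i, j with
    | Sum.inl i, Sum.inl j => B i j
    | Sum.inl _, Sum.inr _ => 0
    | Sum.inr (Sum.inl i), Sum.inl j => if i = j then a else 0
    | Sum.inr (Sum.inl _), Sum.inr _ => b
    | Sum.inr (Sum.inr _), Sum.inl j => if (j : ℕ) = 0 then c else 0
    | Sum.inr (Sum.inr _), Sum.inr _ => d

/-- The vector `(b, …, b, -a)` lies in the kernel of the associated matrix. -/
theorem assocMatrix_mulVec_eq_zero {R : Type*} [CommRing R] {l : ℕ} (hl : 1 ≤ l)
    (B : Matrix (Fin l) (Fin l) R) (hB : ∀ i, ∑ j, B i j = 0)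
    (a b c d : R) (had : a * d = b * c) :
    (assocMatrix B a b c d).mulVec (Sum.elim (fun _ => b) (fun _ => -a)) = 0 := by
  ext (i | i | _)
  · simp [assocMatrix, Matrix.mulVec, dotProduct, ← Finset.sum_mul, hB]
  · simp [assocMatrix, Matrix.mulVec, dotProduct]
    ring
  · have h : ∀ j : Fin l, (j : ℕ) = 0 ↔ j = ⟨0, hl⟩ := fun j => by simp [Fin.ext_iff]
    simp only [assocMatrix, Matrix.mulVec, dotProduct, Fintype.sum_sum_type, h]
    simp
    linear_combination -had

/-- Abstract form of Lemma 3.1(1): over an integral domain, if every row of `B` sums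
to zero, `a·d = b·c` and `(a,b) ≠ (0,0)`, then every `(l+1) × (l+1)` submatrix of the
associated `(2l+1) × (l+1)` matrix obtained by choosing `l+1` of its rows has zero
determinant. -/
theorem stmt4 {R : Type*} [CommRing R] [IsDomain R] {l : ℕ} (hl : 1 ≤ l)
    (B : Matrix (Fin l) (Fin l) R) (hB : ∀ i, ∑ j, B i j = 0)
    (a b c d : R) (had : a * d = b * c) (hab : ¬(a = 0 ∧ b = 0)) :
    ∀ rows : (Fin l ⊕ Unit) → (Fin l ⊕ (Fin l ⊕ Unit)), Function.Injective rows →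
      ((assocMatrix B a b c d).submatrix rows id).det = 0 := by
  intro rows _
  refine Matrix.exists_mulVec_eq_zero_iff.mp ⟨Sum.elim (fun _ => b) (fun _ => -a), ?_, ?_⟩
  · intro h
    exact hab ⟨neg_eq_zero.mp (congrFun h (Sum.inr ())), congrFun h (Sum.inl ⟨0, hl⟩)⟩
  · ext i
    exact congrFun (assocMatrix_mulVec_eq_zero hl B hB a b c d had) (rows i)
end
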